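/- Let A ⊆ ℕ be an infinite set and for each N let A_N denote the set of its N smallest elements. For any strictly increasing sequence of natural numbers (N_t) such that N_t^{-3}·E(A_{N_t}) → 0 as t → ∞, there exists a subsequence of (N_t) along which A has doubly metric Poissonian pair correlations; that is, there is a subsequence (M_t) of (N_t) such that for Lebesgue-almost every (α, γ) ∈ T² and every s > 0, F(α, γ, s, M_t, A) → 2s as t → ∞. -/

import Mathlib

open MeasureTheory Filter Set

noncomputable section

/-- The torus `𝕋 = ℝ/ℤ`, equipped with its Haar (Lebesgue) probability measure `volume`. -/
abbrev 𝕋 := UnitAddCircle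

/-- The increasing enumeration (0-indexed) of a set `A ⊆ ℕ`; for infinite `A`,
`enum A 0 < enum A 1 < ⋯` lists the elements of `A` in increasing order. -/
noncomputable def enum (A : Set ℕ) (n : ℕ) : ℕ := Nat.nth (· ∈ A) n

/-- `A_N`: the set of the `N` smallest elements of `A` (for `A` infinite). -/
noncomputable def firstN (A : Set ℕ) (N : ℕ) : Finset ℕ :=
  (Finset.range N).image (enum A)

/-- Additive energy `E(A) = #{(a,b,c,d) ∈ A⁴ : a + b = c + d}` of a finite set `A ⊆ ℕ`. -/
def addE (A : Finset ℕ) : ℕ :=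
  (((A ×ˢ A) ×ˢ (A ×ˢ A)).filter (fun q => q.1.1 + q.1.2 = q.2.1 + q.2.2)).card

/-- The inhomogeneous pair correlation function
`F(γ, s, N, x) = (1/N) · #{(i,j) ∈ [N]×[N] : i ≠ j, ‖x_i − x_j − γ‖ ≤ s/N}`
of a sequence `x` of points of `𝕋` (indices `0, …, N-1` playing the role of `[N]`). -/
noncomputable def Fseq (γ : 𝕋) (s : ℝ) (N : ℕ) (x : ℕ → 𝕋) : ℝ :=
  (Set.ncard {ij : ℕ × ℕ | ij.1 < N ∧ ij.2 < N ∧ ij.1 ≠ ij.2 ∧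
      ‖x ij.1 - x ij.2 - γ‖ ≤ s / N} : ℝ) / N

/-- `F(α, γ, s, N, 𝒜)`: the pair correlation function of the points `a_n α ∈ 𝕋`,
where `(a_n)` is the increasing enumeration of `A ⊆ ℕ`. -/
noncomputable def Fpc (α γ : 𝕋) (s : ℝ) (N : ℕ) (A : Set ℕ) : ℝ :=
  Fseq γ s N (fun n => (enum A n) • α)

/-- `A ⊆ ℕ` has doubly metric Poissonian pair correlations along the sequence `Nt`:
for Lebesgue-a.e. `(α, γ) ∈ 𝕋²` and every `s > 0`, `F(α, γ, s, N_t, 𝒜) → 2s`. -/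
def DMPPCAlong (A : Set ℕ) (Nt : ℕ → ℕ) : Prop :=
  ∀ᵐ p : 𝕋 × 𝕋, ∀ s : ℝ, 0 < s →
    Tendsto (fun t => Fpc p.1 p.2 s (Nt t) A) atTop (nhds (2 * s))

/-- `A ⊆ ℕ` has doubly metric Poissonian pair correlations. -/
def DMPPC (A : Set ℕ) : Prop := DMPPCAlong A id

instance isProbabilityMeasure_unitAddCircle : IsProbabilityMeasure (volume : Measure 𝕋) :=
  ⟨UnitAddCircle.measure_univ⟩

instance isProbabilityMeasure_unitAddTorus : IsProbabilityMeasure (volume : Measure (𝕋 × 𝕋)) :=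
  inferInstanceAs (IsProbabilityMeasure ((volume : Measure 𝕋).prod volume))

instance isAddHaarMeasure_unitAddTorus : (volume : Measure (𝕋 × 𝕋)).IsAddHaarMeasure :=
  inferInstanceAs ((volume : Measure 𝕋).prod volume).IsAddHaarMeasure

/-- The map `(α, γ) ↦ (m α - γ, n α - γ)` on the two-dimensional torus. -/
def shearHom (m n : ℤ) : 𝕋 × 𝕋 →+ 𝕋 × 𝕋 where
  toFun p := (m • p.1 - p.2, n • p.1 - p.2)
  map_zero' := by simp
  map_add' p q := by
    ext <;> simp only [Prod.fst_add, Prod.snd_add, smul_add] <;> abel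

lemma measurePreserving_shearHom {m n : ℤ} (h : m ≠ n) :
    MeasurePreserving (shearHom m n) (volume : Measure (𝕋 × 𝕋)) volume := by
  refine AddMonoidHom.measurePreserving ?_ ?_ rfl
  · change Continuous fun p : 𝕋 × 𝕋 => (m • p.1 - p.2, n • p.1 - p.2)
    fun_prop
  · rintro ⟨u, v⟩
    have hk : m - n ≠ 0 := sub_ne_zero.mpr h
    refine ⟨(DivisibleBy.div (u - v) (m - n), m • DivisibleBy.div (u - v) (m - n) - u), ?_⟩
    have hdiv := DivisibleBy.div_cancel (u - v) hk
    rw [sub_smul] at hdiv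
    change (m • DivisibleBy.div (u - v) (m - n) - (m • DivisibleBy.div (u - v) (m - n) - u),
      n • DivisibleBy.div (u - v) (m - n) - (m • DivisibleBy.div (u - v) (m - n) - u)) = (u, v)
    ext
    · simp
    · have : n • DivisibleBy.div (u - v) (m - n) - (m • DivisibleBy.div (u - v) (m - n) - u)
        = u - (m • DivisibleBy.div (u - v) (m - n) - n • DivisibleBy.div (u - v) (m - n)) := by
        abel
      simp only [this, hdiv]
      abel

/-- The set of `(α, γ)` for which `m α` lies within distance `r` of `γ`. -/
def strip (r : ℝ) (m : ℤ) : Set (𝕋 × 𝕋) := {p | ‖m • p.1 - p.2‖ ≤ r}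

lemma measurableSet_strip (r : ℝ) (m : ℤ) : MeasurableSet (strip r m) := by
  refine (isClosed_le ?_ continuous_const).measurableSet
  fun_prop

/-- The measure of a ball of radius `r` in the circle, as a real number. -/
def ballVol (r : ℝ) : ℝ := volume.real (Metric.closedBall (0 : 𝕋) r)

lemma ballVol_eq {r : ℝ} (hr : 0 ≤ r) : ballVol r = min 1 (2 * r) := by
  rw [ballVol, Measure.real, AddCircle.volume_closedBall, ENNReal.toReal_ofReal (by positivity)]

lemma measureReal_strip_inter (r : ℝ) {m n : ℤ} (h : m ≠ n) :
    volume.real (strip r m ∩ strip r n) = ballVol r ^ 2 := by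
  have hpre : strip r m ∩ strip r n = shearHom m n ⁻¹'
      (Metric.closedBall (0 : 𝕋) r ×ˢ Metric.closedBall (0 : 𝕋) r) := by
    ext p
    simp [strip, shearHom]
  rw [hpre, (measurePreserving_shearHom h).measureReal_preimage
    (measurableSet_closedBall.prod measurableSet_closedBall).nullMeasurableSet,
    Measure.volume_eq_prod, measureReal_prod_prod, ballVol, sq]

lemma measureReal_strip (r : ℝ) (m : ℤ) : volume.real (strip r m) = ballVol r := by
  have hpre : strip r m = shearHom m (m + 1) ⁻¹' (Metric.closedBall (0 : 𝕋) r ×ˢ univ) := by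
    ext p
    simp [strip, shearHom]
  rw [hpre, (measurePreserving_shearHom (by simp)).measureReal_preimage
    (measurableSet_closedBall.prod MeasurableSet.univ).nullMeasurableSet,
    Measure.volume_eq_prod, measureReal_prod_prod, ballVol, probReal_univ, mul_one]

lemma integrable_indicator_strip (r : ℝ) (m : ℤ) :
    Integrable ((strip r m).indicator (1 : 𝕋 × 𝕋 → ℝ)) volume :=
  (integrable_const (1 : ℝ)).indicator (measurableSet_strip r m)

lemma integrable_indicator_strip_mul (r : ℝ) (m n : ℤ) :
    Integrable (fun p => ((strip r m).indicator (1 : 𝕋 × 𝕋 → ℝ) p - ballVol r) *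
      ((strip r n).indicator (1 : 𝕋 × 𝕋 → ℝ) p - ballVol r)) volume := by
  refine Integrable.bdd_mul (c := 1 + |ballVol r|)
    ((integrable_indicator_strip r n).sub (integrable_const _))
    ((integrable_indicator_strip r m).sub (integrable_const _)).aestronglyMeasurable
    (Eventually.of_forall fun p => ?_)
  refine (norm_sub_le _ _).trans (add_le_add ?_ le_rfl)
  by_cases hp : p ∈ strip r m <;> simp [hp]

lemma integral_indicator_strip_mul (r : ℝ) (m n : ℤ) :
    ∫ p, ((strip r m).indicator (1 : 𝕋 × 𝕋 → ℝ) p - ballVol r) *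
      ((strip r n).indicator (1 : 𝕋 × 𝕋 → ℝ) p - ballVol r) =
      volume.real (strip r m ∩ strip r n) - ballVol r ^ 2 := by
  have hexp : ∀ p : 𝕋 × 𝕋, ((strip r m).indicator (1 : 𝕋 × 𝕋 → ℝ) p - ballVol r) *
      ((strip r n).indicator (1 : 𝕋 × 𝕋 → ℝ) p - ballVol r) =
      (strip r m ∩ strip r n).indicator (1 : 𝕋 × 𝕋 → ℝ) p
        - ballVol r * (strip r m).indicator (1 : 𝕋 × 𝕋 → ℝ) p
        - ballVol r * (strip r n).indicator (1 : 𝕋 × 𝕋 → ℝ) p + ballVol r ^ 2 := by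
    intro p
    rw [inter_indicator_one, Pi.mul_apply]
    ring
  have hm := (integrable_indicator_strip r m).const_mul (ballVol r)
  have hn := (integrable_indicator_strip r n).const_mul (ballVol r)
  have hi : Integrable ((strip r m ∩ strip r n).indicator (1 : 𝕋 × 𝕋 → ℝ)) volume :=
    (integrable_const (1 : ℝ)).indicator ((measurableSet_strip r m).inter (measurableSet_strip r n))
  have him : Integrable (fun p => (strip r m ∩ strip r n).indicator (1 : 𝕋 × 𝕋 → ℝ) p
      - ballVol r * (strip r m).indicator (1 : 𝕋 × 𝕋 → ℝ) p) volume := hi.sub hm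
  have himn : Integrable (fun p => (strip r m ∩ strip r n).indicator (1 : 𝕋 × 𝕋 → ℝ) p
      - ballVol r * (strip r m).indicator (1 : 𝕋 × 𝕋 → ℝ) p
      - ballVol r * (strip r n).indicator (1 : 𝕋 × 𝕋 → ℝ) p) volume := him.sub hn
  simp_rw [hexp]
  rw [integral_add himn (integrable_const _), integral_sub him hn,
    integral_sub hi hm, integral_const_mul, integral_const_mul,
    integral_indicator_one (measurableSet_strip r m),
    integral_indicator_one (measurableSet_strip r n),
    integral_indicator_one ((measurableSet_strip r m).inter (measurableSet_strip r n)),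
    measureReal_strip, measureReal_strip, integral_const, probReal_univ, one_smul]
  ring

lemma integral_indicator_strip_mul_le (r : ℝ) (m n : ℤ) :
    ∫ p, ((strip r m).indicator (1 : 𝕋 × 𝕋 → ℝ) p - ballVol r) *
      ((strip r n).indicator (1 : 𝕋 × 𝕋 → ℝ) p - ballVol r) ≤
      if m = n then ballVol r else 0 := by
  rw [integral_indicator_strip_mul]
  split_ifs with h
  · subst h
    rw [inter_self, measureReal_strip]
    nlinarith [sq_nonneg (ballVol r)]
  · rw [measureReal_strip_inter r h, sub_self]

lemma sq_sum_eq_sum_product {ι : Type*} (P : Finset ι) (f : ι → ℝ) :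
    (∑ i ∈ P, f i) ^ 2 = ∑ q ∈ P ×ˢ P, f q.1 * f q.2 := by
  rw [sq, Finset.sum_mul_sum, Finset.sum_product]

lemma integrable_sq_sum_indicator_strip {ι : Type*} (P : Finset ι) (d : ι → ℤ) (r : ℝ) :
    Integrable (fun p => (∑ i ∈ P, ((strip r (d i)).indicator (1 : 𝕋 × 𝕋 → ℝ) p - ballVol r)) ^ 2)
      volume := by
  simp_rw [sq_sum_eq_sum_product]
  exact integrable_finsetSum _ fun q _ => integrable_indicator_strip_mul r _ _

lemma integral_sq_sum_indicator_strip_le {ι : Type*} (P : Finset ι) (d : ι → ℤ) (r : ℝ) :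
    ∫ p, (∑ i ∈ P, ((strip r (d i)).indicator (1 : 𝕋 × 𝕋 → ℝ) p - ballVol r)) ^ 2 ≤
      ((P ×ˢ P).filter fun q => d q.1 = d q.2).card * ballVol r := by
  simp_rw [sq_sum_eq_sum_product]
  rw [integral_finsetSum _ fun q _ => integrable_indicator_strip_mul r _ _]
  refine (Finset.sum_le_sum fun q _ => integral_indicator_strip_mul_le r _ _).trans_eq ?_
  rw [← Finset.sum_filter, Finset.sum_const, nsmul_eq_mul]

lemma enum_injective {A : Set ℕ} (hA : A.Infinite) : Function.Injective (enum A) :=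
  Nat.nth_injective hA

/-- The difference `a_i - a_j` of two elements of `A`, as an integer. -/
def enumDiff (A : Set ℕ) (ij : ℕ × ℕ) : ℤ := (enum A ij.1 : ℤ) - enum A ij.2

lemma card_enumDiff_eq_le_addE {A : Set ℕ} (hA : A.Infinite) (N : ℕ) :
    (((Finset.range N).offDiag ×ˢ (Finset.range N).offDiag).filter
      fun q => enumDiff A q.1 = enumDiff A q.2).card ≤ addE (firstN A N) := by
  refine Finset.card_le_card_of_injOn
    (fun q => ((enum A q.1.1, enum A q.2.2), (enum A q.2.1, enum A q.1.2))) ?_ ?_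
  · rintro ⟨⟨i, j⟩, k, l⟩ hq
    replace hq := Finset.mem_filter.mp hq
    simp only [Finset.mem_product, Finset.mem_offDiag, Finset.mem_range, enumDiff] at hq
    have hmem : ∀ i < N, enum A i ∈ firstN A N := fun i hi =>
      Finset.mem_image_of_mem _ (Finset.mem_range.mpr hi)
    simp only [Finset.mem_coe, Finset.mem_filter, Finset.mem_product]
    refine ⟨⟨⟨hmem _ hq.1.1.1, hmem _ hq.1.2.2.1⟩, hmem _ hq.1.2.1, hmem _ hq.1.1.2.1⟩, ?_⟩
    have := hq.2
    omega
  · rintro ⟨⟨i, j⟩, k, l⟩ _ ⟨⟨i', j'⟩, k', l'⟩ _ h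
    simp only [Prod.mk.injEq, (enum_injective hA).eq_iff] at h ⊢
    tauto

lemma Fpc_eq_sum (A : Set ℕ) (p : 𝕋 × 𝕋) (s : ℝ) (N : ℕ) :
    Fpc p.1 p.2 s N A = (∑ ij ∈ (Finset.range N).offDiag,
      (strip (s / N) (enumDiff A ij)).indicator (1 : 𝕋 × 𝕋 → ℝ) p) / N := by
  classical
  rw [Fpc, Fseq]
  congr 1
  have hset : {ij : ℕ × ℕ | ij.1 < N ∧ ij.2 < N ∧ ij.1 ≠ ij.2 ∧
      ‖enum A ij.1 • p.1 - enum A ij.2 • p.1 - p.2‖ ≤ s / N} =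
      ((Finset.range N).offDiag.filter fun ij => p ∈ strip (s / N) (enumDiff A ij) :
        Finset (ℕ × ℕ)) := by
    ext ij
    simp [strip, enumDiff, sub_smul, and_assoc]
  rw [hset, Set.ncard_coe_finset, Finset.card_filter, Nat.cast_sum]
  refine Finset.sum_congr rfl fun ij _ => ?_
  by_cases h : p ∈ strip (s / N) (enumDiff A ij) <;> simp [h]

/-- The average of `F(α, γ, s, N, A)` over `(α, γ)`. -/
def meanF (s : ℝ) (N : ℕ) : ℝ := (Finset.range N).offDiag.card * ballVol (s / N) / N

lemma sq_Fpc_sub_meanF (A : Set ℕ) (p : 𝕋 × 𝕋) (s : ℝ) (N : ℕ) :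
    (Fpc p.1 p.2 s N A - meanF s N) ^ 2 = (∑ ij ∈ (Finset.range N).offDiag,
      ((strip (s / N) (enumDiff A ij)).indicator (1 : 𝕋 × 𝕋 → ℝ) p - ballVol (s / N))) ^ 2
      / N ^ 2 := by
  rw [Fpc_eq_sum, meanF, Finset.sum_sub_distrib, Finset.sum_const, nsmul_eq_mul, ← sub_div, div_pow]

lemma integrable_sq_Fpc_sub_meanF (A : Set ℕ) (s : ℝ) (N : ℕ) :
    Integrable (fun p : 𝕋 × 𝕋 => (Fpc p.1 p.2 s N A - meanF s N) ^ 2) volume := by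
  simp_rw [sq_Fpc_sub_meanF]
  exact (integrable_sq_sum_indicator_strip _ _ _).div_const _

lemma integral_sq_Fpc_sub_meanF_le {A : Set ℕ} (hA : A.Infinite) {s : ℝ} (hs : 0 ≤ s) (N : ℕ) :
    ∫ p : 𝕋 × 𝕋, (Fpc p.1 p.2 s N A - meanF s N) ^ 2 ≤
      2 * s * ((addE (firstN A N) : ℝ) / (N : ℝ) ^ 3) := by
  simp_rw [sq_Fpc_sub_meanF]
  rw [integral_div]
  have hr : 0 ≤ s / N := by positivity
  have hv : ballVol (s / N) ≤ 2 * (s / N) := (ballVol_eq hr).trans_le (min_le_right _ _)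
  have hcard : ((((Finset.range N).offDiag ×ˢ (Finset.range N).offDiag).filter
      fun q => enumDiff A q.1 = enumDiff A q.2).card : ℝ) ≤ addE (firstN A N) := by
    exact_mod_cast card_enumDiff_eq_le_addE hA N
  calc _ ≤ (addE (firstN A N) : ℝ) * (2 * (s / N)) / (N : ℝ) ^ 2 := by
        gcongr
        exact (integral_sq_sum_indicator_strip_le _ _ _).trans
          (mul_le_mul hcard hv measureReal_nonneg (by positivity))
    _ = _ := by
        rcases eq_or_ne (N : ℝ) 0 with h | h
        · simp [h]
        · field_simp

lemma tendsto_meanF {s : ℝ} (hs : 0 ≤ s) : Tendsto (meanF s) atTop (nhds (2 * s)) := by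
  have hlim : Tendsto (fun N : ℕ => 2 * s * (1 - 1 / (N : ℝ))) atTop (nhds (2 * s)) := by
    simpa using (tendsto_one_div_atTop_nhds_zero_nat.const_sub (1 : ℝ)).const_mul (2 * s)
  refine hlim.congr' ?_
  filter_upwards [eventually_ge_atTop 1, eventually_ge_atTop ⌈2 * s⌉₊] with N hN hNs
  have hN0 : (0 : ℝ) < N := by exact_mod_cast hN
  have hle : 2 * s ≤ N := Nat.ceil_le.mp hNs
  have hmin : 2 * (s / N) ≤ 1 := by
    rw [← mul_div_assoc]
    exact (div_le_one hN0).mpr hle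
  rw [meanF, ballVol_eq (by positivity), min_eq_right hmin, Finset.offDiag_card, Finset.card_range,
    Nat.cast_sub (Nat.le_mul_self N), Nat.cast_mul]
  field_simp

/-- Nonnegative functions with summably bounded integrals tend to zero almost everywhere. -/
lemma ae_tendsto_zero_of_integral_le {Ω : Type*} [MeasurableSpace Ω] {μ : Measure Ω}
    {f : ℕ → Ω → ℝ} {b : ℕ → ℝ} (hf : ∀ n, Integrable (f n) μ) (hf0 : ∀ n x, 0 ≤ f n x)
    (hle : ∀ n, ∫ x, f n x ∂μ ≤ b n) (hb : Summable b) :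
    ∀ᵐ x ∂μ, Tendsto (fun n => f n x) atTop (nhds 0) := by
  have hmeas : ∀ n, AEMeasurable (fun x => ENNReal.ofReal (f n x)) μ := fun n =>
    (hf n).aemeasurable.ennreal_ofReal
  have hfin : ∫⁻ x, ∑' n, ENNReal.ofReal (f n x) ∂μ ≠ ⊤ := by
    rw [lintegral_tsum hmeas]
    refine ne_top_of_le_ne_top hb.tsum_ofReal_ne_top (ENNReal.tsum_le_tsum fun n => ?_)
    rw [← ofReal_integral_eq_lintegral_ofReal (hf n) (Eventually.of_forall (hf0 n))]
    exact ENNReal.ofReal_le_ofReal (hle n)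
  filter_upwards [ae_lt_top' (AEMeasurable.tsum hmeas) hfin] with x hx
  have h := (ENNReal.tendsto_toReal ENNReal.zero_ne_top).comp
    (ENNReal.tendsto_atTop_zero_of_tsum_ne_top hx.ne)
  refine h.congr fun n => ?_
  simp [ENNReal.toReal_ofReal (hf0 n x)]

lemma Fpc_mono (α γ : 𝕋) {s s' : ℝ} (h : s ≤ s') (N : ℕ) (A : Set ℕ) :
    Fpc α γ s N A ≤ Fpc α γ s' N A := by
  unfold Fpc Fseq
  refine div_le_div_of_nonneg_right ?_ (Nat.cast_nonneg N)
  refine Nat.cast_le.mpr (Set.ncard_le_ncard ?_ ?_)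
  · rintro ij ⟨h1, h2, h3, h4⟩
    exact ⟨h1, h2, h3, h4.trans (div_le_div_of_nonneg_right h (Nat.cast_nonneg N))⟩
  · exact ((finite_Iio N).prod (finite_Iio N)).subset fun ij hij => ⟨hij.1, hij.2.1⟩

/-- For families of monotone functions, convergence to a linear limit on the positive rationals
implies convergence on the positive reals. -/
lemma tendsto_of_forall_rat {G : ℝ → ℕ → ℝ} (hmono : ∀ t, Monotone fun s => G s t)
    (h : ∀ q : ℚ, 0 < q → Tendsto (G q) atTop (nhds (2 * (q : ℝ)))) {s : ℝ} (hs : 0 < s) :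
    Tendsto (G s) atTop (nhds (2 * s)) := by
  refine tendsto_order.mpr ⟨fun a ha => ?_, fun a ha => ?_⟩
  · obtain ⟨q, hq1, hq2⟩ := exists_rat_btwn (max_lt hs (show a / 2 < s by linarith))
    have hq0 : (0 : ℚ) < q := by exact_mod_cast (le_max_left _ _).trans_lt hq1
    have hqa : a / 2 < q := (le_max_right _ _).trans_lt hq1
    filter_upwards [(h q hq0).eventually_const_lt (show a < 2 * (q : ℝ) by linarith)] with t ht
    exact ht.trans_le (hmono t hq2.le)
  · obtain ⟨q, hq1, hq2⟩ := exists_rat_btwn (show s < a / 2 by linarith)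
    have hq0 : (0 : ℚ) < q := by exact_mod_cast hs.trans hq1
    filter_upwards [(h q hq0).eventually_lt_const (show 2 * (q : ℝ) < a by linarith)] with t ht
    exact (hmono t hq1.le).trans_lt ht

lemma ae_tendsto_Fpc {A : Set ℕ} (hA : A.Infinite) {M : ℕ → ℕ} (hM : Tendsto M atTop atTop)
    (hsum : Summable fun t => (addE (firstN A (M t)) : ℝ) / (M t : ℝ) ^ 3) {s : ℝ} (hs : 0 ≤ s) :
    ∀ᵐ p : 𝕋 × 𝕋, Tendsto (fun t => Fpc p.1 p.2 s (M t) A) atTop (nhds (2 * s)) := by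
  filter_upwards [ae_tendsto_zero_of_integral_le
    (fun t => integrable_sq_Fpc_sub_meanF A s (M t)) (fun t p => sq_nonneg _)
    (fun t => integral_sq_Fpc_sub_meanF_le hA hs (M t)) (hsum.mul_left (2 * s))] with p hp
  have habs : Tendsto (fun t => |Fpc p.1 p.2 s (M t) A - meanF s (M t)|) atTop (nhds 0) := by
    simpa [Real.sqrt_sq_eq_abs] using hp.sqrt
  simpa using ((tendsto_zero_iff_abs_tendsto_zero _).mpr habs).add ((tendsto_meanF hs).comp hM)

/-- **Theorem.** If `A ⊆ ℕ` is infinite and `(N_t)` is strictly increasing with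
`N_t⁻³·E(A_{N_t}) → 0`, then some subsequence `(N_{φ(t)})` of `(N_t)` is such that `A` has
doubly metric Poissonian pair correlations along it. -/
theorem stmt_2 (A : Set ℕ) (hA : A.Infinite) (Nt : ℕ → ℕ) (hNt : StrictMono Nt)
    (hE : Tendsto (fun t => (addE (firstN A (Nt t)) : ℝ) / (Nt t : ℝ) ^ 3) atTop (nhds 0)) :
    ∃ φ : ℕ → ℕ, StrictMono φ ∧ DMPPCAlong A (Nt ∘ φ) := by
  obtain ⟨φ, hφ, hbound⟩ := extraction_forall_of_eventually fun n : ℕ =>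
    hE.eventually_le_const (show (0 : ℝ) < (1 / 2) ^ n by positivity)
  refine ⟨φ, hφ, ?_⟩
  have hsum : Summable fun t =>
      (addE (firstN A ((Nt ∘ φ) t)) : ℝ) / ((Nt ∘ φ) t : ℝ) ^ 3 :=
    Summable.of_nonneg_of_le (fun t => by positivity) hbound summable_geometric_two
  have hall : ∀ᵐ p : 𝕋 × 𝕋, ∀ q : ℚ, 0 < q →
      Tendsto (fun t => Fpc p.1 p.2 q ((Nt ∘ φ) t) A) atTop (nhds (2 * (q : ℝ))) := by
    refine ae_all_iff.mpr fun q => ?_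
    by_cases hq : 0 < q
    · filter_upwards [ae_tendsto_Fpc hA (hNt.comp hφ).tendsto_atTop hsum
        (s := q) (by exact_mod_cast hq.le)] with p hp _
      exact hp
    · exact Eventually.of_forall fun p h => absurd h hq
  filter_upwards [hall] with p hp s hs
  exact tendsto_of_forall_rat (G := fun s t => Fpc p.1 p.2 s ((Nt ∘ φ) t) A)
    (fun t s s' h => Fpc_mono _ _ h _ _) hp hs
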